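/- arXiv:2205.03368 — 3 statements merged into one kernel-verified Lean document; each statement's English description precedes it below -/
import Mathlib

section
/- Let S ⊂ ℝ^d be the regular simplex of radius one with uniform probability measure U, and define p_S(x) = ∫_S 1_{B_y}(x)/U(B_y) dU(y), where B_y is the largest ball centered at y contained in S. If g: S → ℝ is a convex (hence continuous) function with ∫_S g dU = 0 which is not affine, then ∫_S g(x) p_S(x) dU(x) > 0. -/
open MeasureTheory Metric Set
open scoped ENNReal NNReal

/-- The uniform probability measure on a set `S`. -/
noncomputable def unifMeasure {d : ℕ} (S : Set (EuclideanSpace ℝ (Fin d))) :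
    MeasureTheory.Measure (EuclideanSpace ℝ (Fin d)) :=
  (volume S)⁻¹ • volume.restrict S

/-- `v` lists the vertices of a regular simplex of (circum)radius one in `ℝ^d`. -/
def IsRegularSimplexRadiusOne {d : ℕ} (v : Fin (d + 1) → EuclideanSpace ℝ (Fin d)) :
    Prop :=
  AffineIndependent ℝ v ∧
  (∀ i j k l, i ≠ j → k ≠ l → dist (v i) (v j) = dist (v k) (v l)) ∧
  ∀ i, dist (Finset.centroid ℝ Finset.univ v) (v i) = 1

/-- `p_S(x) = ∫_S 1_{B_y}(x)/U(B_y) dU(y)`, where `B_y` is the largest ball centered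
at `y` contained in `S` and `U` is the uniform probability measure on `S`. -/
noncomputable def pS {d : ℕ} (S : Set (EuclideanSpace ℝ (Fin d)))
    (x : EuclideanSpace ℝ (Fin d)) : ℝ :=
  ∫ y, (Metric.closedBall y (Metric.infDist y Sᶜ)).indicator (fun _ => (1 : ℝ)) x /
      ((unifMeasure S) (Metric.closedBall y (Metric.infDist y Sᶜ))).toReal
    ∂(unifMeasure S)

open scoped Topology

/-- A convex function has a subgradient at every interior point of its domain. -/
theorem ConvexOn.exists_subgradient {E : Type*} [NormedAddCommGroup E] [NormedSpace ℝ E]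
    {s : Set E} {g : E → ℝ} (hg : ConvexOn ℝ s g) (hc : ContinuousOn g (interior s))
    {y : E} (hy : y ∈ interior s) :
    ∃ L : E →L[ℝ] ℝ, ∀ x ∈ s, g y + L (x - y) ≤ g x := by
  have hgi : ConvexOn ℝ (interior s) g := hg.subset interior_subset hg.1.interior
  have hopen : IsOpen {p : E × ℝ | p.1 ∈ interior s ∧ g p.1 < p.2} := by
    have h1 : ContinuousOn (fun p : E × ℝ => p.2 - g p.1) (interior s ×ˢ univ) :=
      continuousOn_snd.sub (hc.comp continuousOn_fst fun p hp => hp.1)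
    convert! h1.isOpen_inter_preimage (isOpen_interior.prod isOpen_univ) (isOpen_Ioi (a := 0))
      using 1
    ext p
    simp
  obtain ⟨f, hf⟩ := geometric_hahn_banach_open_point hgi.convex_strict_epigraph hopen
    (x := (y, g y)) (by simp)
  have hsplit (x : E) (t : ℝ) : f (x, t) = f (x, 0) + t * f (0, 1) := by
    rw [← smul_eq_mul, ← map_smul, ← map_add]
    simp
  have hneg : f (0, 1) < 0 := by
    have h1 := hf (y, g y + 1) ⟨hy, by simp⟩
    rw [hsplit, hsplit y (g y)] at h1
    linarith
  have hle (x : E) (hx : x ∈ interior s) :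
      f (x, 0) + g x * f (0, 1) ≤ f (y, 0) + g y * f (0, 1) := by
    refine le_of_forall_pos_lt_add fun ε hε => ?_
    have h1 := hf (x, g x + ε / -f (0, 1)) ⟨hx, by
      have : 0 < ε / -f (0, 1) := div_pos hε (by linarith)
      simpa using this⟩
    rw [hsplit, hsplit y (g y), add_mul, div_neg, neg_mul, div_mul_cancel₀ _ hneg.ne] at h1
    linarith
  set L : E →L[ℝ] ℝ := (-(f (0, 1)))⁻¹ • f.comp (ContinuousLinearMap.inl ℝ E ℝ) with hL
  refine ⟨L, ?_⟩
  have hcv : ConvexOn ℝ s fun x => g x - L x :=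
    hg.sub (L.toLinearMap.concaveOn hg.1)
  have hmin : IsMinOn (fun x => g x - L x) s y := by
    refine IsMinOn.of_isLocalMinOn_of_convexOn (interior_subset hy) ?_ hcv
    refine Filter.Eventually.filter_mono nhdsWithin_le_nhds ?_
    filter_upwards [isOpen_interior.mem_nhds hy] with x hx
    have h1 := hle x hx
    have h2 : ∀ x, f (x, 0) = L x * (-f (0, 1)) := fun x => by
      have : f (0, 1) ≠ 0 := hneg.ne
      simp [hL]
      field_simp
    rw [h2, h2 y] at h1
    nlinarith
  intro x hx
  have := hmin hx
  simp only [mem_ofPred_eq] at this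
  rw [map_sub]
  linarith

/-- Linear forms centered at `y` have vanishing integral over balls centered at `y`. -/
theorem setIntegral_closedBall_map_sub {E : Type*} [NormedAddCommGroup E] [NormedSpace ℝ E]
    [MeasurableSpace E] [BorelSpace E] (μ : Measure E)
    [μ.IsAddLeftInvariant] [μ.IsNegInvariant] (L : E →L[ℝ] ℝ) (y : E) (r : ℝ) :
    ∫ x in closedBall y r, L (x - y) ∂μ = 0 := by
  rw [← integral_indicator isClosed_closedBall.measurableSet]
  set f := (closedBall y r).indicator fun x => L (x - y) with hf
  have h1 (x : E) : f (y + y - x) = -f x := by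
    have hiff : y + y - x ∈ closedBall y r ↔ x ∈ closedBall y r := by
      simp only [mem_closedBall, dist_eq_norm]
      rw [show y + y - x - y = -(x - y) by abel, norm_neg]
    by_cases hx : x ∈ closedBall y r
    · rw [hf, indicator_of_mem hx, indicator_of_mem (hiff.2 hx), ← map_neg]
      congr 1
      abel
    · rw [hf, indicator_of_notMem hx, indicator_of_notMem (mt hiff.1 hx), neg_zero]
  have h2 := integral_sub_left_eq_self f μ (y + y)
  simp_rw [h1, integral_neg] at h2
  linarith

/-- A locally affine function on a preconnected open set is affine. -/
theorem IsOpen.exists_eq_affine_of_locally {E : Type*} [NormedAddCommGroup E] [NormedSpace ℝ E]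
    {s : Set E} (hs : IsOpen s) (hs' : IsPreconnected s) {g : E → ℝ}
    (hg : ∀ z ∈ s, ∃ (L : E →L[ℝ] ℝ) (a : ℝ), ∀ᶠ x in 𝓝 z, g x = L x + a) :
    ∃ (L : E →L[ℝ] ℝ) (a : ℝ), ∀ x ∈ s, g x = L x + a := by
  have hd : ∀ z ∈ s, ∃ L : E →L[ℝ] ℝ, ∀ᶠ x in 𝓝 z, HasFDerivAt g L x := by
    intro z hz
    obtain ⟨L, a, h⟩ := hg z hz
    refine ⟨L, ?_⟩
    filter_upwards [h.eventually_nhds] with x hx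
    exact (L.hasFDerivAt.add_const a).congr_of_eventuallyEq hx
  have hd2 : ∀ z ∈ s, HasFDerivAt (fderiv ℝ g) (0 : E →L[ℝ] E →L[ℝ] ℝ) z := by
    intro z hz
    obtain ⟨L, h⟩ := hd z hz
    exact (hasFDerivAt_const L z).congr_of_eventuallyEq (h.mono fun x hx => hx.fderiv)
  obtain ⟨L, hL⟩ := hs.exists_is_const_of_fderiv_eq_zero (𝕜 := ℝ) hs'
    (fun z hz => (hd2 z hz).differentiableAt.differentiableWithinAt) fun z hz => (hd2 z hz).fderiv
  obtain ⟨a, ha⟩ := hs.exists_eq_add_of_fderiv_eq (𝕜 := ℝ) (g := L) hs'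
    (fun z hz => by
      obtain ⟨M, h⟩ := hd z hz
      exact h.self_of_nhds.differentiableAt.differentiableWithinAt)
    L.differentiable.differentiableOn fun z hz => by rw [hL z hz, L.fderiv]
  exact ⟨L, a, ha⟩

/-- Mean value inequality for convex functions on balls, with its equality case. -/
theorem ConvexOn.mul_measureReal_closedBall_le {E : Type*} [NormedAddCommGroup E]
    [NormedSpace ℝ E] [FiniteDimensional ℝ E] [MeasurableSpace E] [BorelSpace E]
    (μ : Measure E) [μ.IsAddHaarMeasure] {s : Set E} {g : E → ℝ} (hg : ConvexOn ℝ s g)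
    (hc : ContinuousOn g s) {y : E} {r : ℝ} (hr : 0 < r) (hs : closedBall y r ⊆ s) :
    g y * μ.real (closedBall y r) ≤ ∫ x in closedBall y r, g x ∂μ ∧
      (∫ x in closedBall y r, g x ∂μ = g y * μ.real (closedBall y r) →
        ∃ (L : E →L[ℝ] ℝ) (a : ℝ), ∀ x ∈ ball y r, g x = L x + a) := by
  have hy : y ∈ interior s :=
    mem_interior.2 ⟨ball y r, ball_subset_closedBall.trans hs, isOpen_ball, mem_ball_self hr⟩
  obtain ⟨L, hL⟩ := hg.exists_subgradient (hc.mono interior_subset) hy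
  have hK : IsCompact (closedBall y r) := isCompact_closedBall y r
  have hgi : IntegrableOn g (closedBall y r) μ := (hc.mono hs).integrableOn_compact hK
  have hci : IntegrableOn (fun _ => g y) (closedBall y r) μ :=
    continuousOn_const.integrableOn_compact hK
  have hLi : IntegrableOn (fun x => L (x - y)) (closedBall y r) μ :=
    (by fun_prop : Continuous fun x => L (x - y)).continuousOn.integrableOn_compact hK
  have hgap : ∫ x in closedBall y r, (g x - g y - L (x - y)) ∂μ =
      ∫ x in closedBall y r, g x ∂μ - g y * μ.real (closedBall y r) := by
    rw [integral_sub (f := fun x => g x - g y) (hgi.sub hci) hLi, integral_sub hgi hci, setIntegral_closedBall_map_sub,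
      setIntegral_const, smul_eq_mul, mul_comm, sub_zero]
  have hnonneg : ∀ᵐ x ∂μ.restrict (closedBall y r), 0 ≤ g x - g y - L (x - y) := by
    filter_upwards [ae_restrict_mem hK.measurableSet] with x hx
    linarith [hL x (hs hx)]
  refine ⟨?_, fun heq => ⟨L, g y - L y, ?_⟩⟩
  · have := integral_nonneg_of_ae hnonneg
    linarith
  · rw [heq, sub_self, integral_eq_zero_iff_of_nonneg_ae hnonneg ((hgi.sub hci).sub hLi)] at hgap
    have hae : g =ᵐ[μ.restrict (ball y r)] fun x => L x + (g y - L y) := by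
      filter_upwards [ae_restrict_of_ae_restrict_of_subset ball_subset_closedBall hgap] with x hx
      simp only [Pi.zero_apply, map_sub] at hx
      linarith
    exact Measure.eqOn_open_of_ae_eq hae isOpen_ball
      (hc.mono (ball_subset_closedBall.trans hs)) (by fun_prop)

section MaximalBalls

variable {d : ℕ} {K : Set (EuclideanSpace ℝ (Fin d))}

theorem isProbabilityMeasure_unifMeasure (hK : IsCompact K) (hne : (interior K).Nonempty) :
    IsProbabilityMeasure (unifMeasure K) := by
  refine ⟨?_⟩
  rw [unifMeasure, Measure.smul_apply, Measure.restrict_apply_univ, smul_eq_mul]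
  exact ENNReal.inv_mul_cancel (Measure.measure_pos_of_nonempty_interior _ hne).ne' hK.measure_lt_top.ne

/-- Almost every point for the uniform measure on a compact convex body is interior. -/
theorem ae_mem_interior_unifMeasure (hK : IsCompact K) (hconv : Convex ℝ K) :
    ∀ᵐ y ∂unifMeasure K, y ∈ interior K := by
  refine Measure.ae_smul_measure ?_ _
  rw [ae_restrict_iff' hK.measurableSet]
  filter_upwards [measure_eq_zero_iff_ae_notMem.1 (hconv.addHaar_frontier volume)] with y hy hyK
  by_contra h
  exact hy ⟨subset_closure hyK, h⟩

theorem infDist_compl_pos (hK : Kᶜ.Nonempty) {y : EuclideanSpace ℝ (Fin d)}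
    (hy : y ∈ interior K) : 0 < infDist y Kᶜ := by
  rw [← infDist_closure]
  refine (isClosed_closure.notMem_iff_infDist_pos hK.closure).1 ?_
  rw [closure_compl]
  simpa using hy

theorem closedBall_infDist_compl_subset (hK : IsClosed K) {y : EuclideanSpace ℝ (Fin d)}
    (hy : y ∈ K) : closedBall y (infDist y Kᶜ) ⊆ K := by
  have := closedBall_infDist_compl_subset_closure hy
  rwa [hK.closure_eq] at this

/-- Mean value inequality over the maximal ball at `y`, for the uniform measure. -/
theorem le_setIntegral_unifMeasure_div (hK : IsCompact K) (hne : (interior K).Nonempty)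
    (hKc : Kᶜ.Nonempty) {g : EuclideanSpace ℝ (Fin d) → ℝ} (hg : ConvexOn ℝ K g)
    (hc : ContinuousOn g K) {y : EuclideanSpace ℝ (Fin d)} (hy : y ∈ interior K) :
    g y ≤ (∫ x in closedBall y (infDist y Kᶜ), g x ∂unifMeasure K) /
        (unifMeasure K (closedBall y (infDist y Kᶜ))).toReal ∧
      ((∫ x in closedBall y (infDist y Kᶜ), g x ∂unifMeasure K) /
        (unifMeasure K (closedBall y (infDist y Kᶜ))).toReal = g y →
        ∃ (L : EuclideanSpace ℝ (Fin d) →L[ℝ] ℝ) (a : ℝ),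
          ∀ x ∈ ball y (infDist y Kᶜ), g x = L x + a) := by
  have hr := infDist_compl_pos hKc hy
  have hs := closedBall_infDist_compl_subset hK.isClosed (interior_subset hy)
  set B := closedBall y (infDist y Kᶜ) with hB
  have hc0 : 0 < ((volume K)⁻¹).toReal :=
    ENNReal.toReal_pos (ENNReal.inv_ne_zero.2 hK.measure_lt_top.ne)
      (ENNReal.inv_ne_top.2 (Measure.measure_pos_of_nonempty_interior _ hne).ne')
  have hres : (unifMeasure K).restrict B = (volume K)⁻¹ • volume.restrict B := by
    rw [unifMeasure, Measure.restrict_smul, Measure.restrict_restrict_of_subset hs]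
  have hU : (unifMeasure K B).toReal = ((volume K)⁻¹).toReal * volume.real B := by
    rw [← Measure.restrict_apply_self, hres, Measure.smul_apply, Measure.restrict_apply_self,
      smul_eq_mul, ENNReal.toReal_mul, Measure.real]
  have hvol : 0 < volume.real B :=
    ENNReal.toReal_pos (measure_closedBall_pos _ _ hr).ne' measure_closedBall_lt_top.ne
  rw [hU, hres, integral_smul_measure, smul_eq_mul, mul_div_mul_left _ _ hc0.ne',
    le_div_iff₀ hvol, div_eq_iff hvol.ne']
  exact hg.mul_measureReal_closedBall_le volume hc hr hs

/-- The kernel whose integral over `y` defines `pS`. -/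
noncomputable def ballKernel (K : Set (EuclideanSpace ℝ (Fin d)))
    (x y : EuclideanSpace ℝ (Fin d)) : ℝ :=
  (closedBall y (infDist y Kᶜ)).indicator (fun _ => (1 : ℝ)) x /
    ((unifMeasure K) (closedBall y (infDist y Kᶜ))).toReal

theorem measurable_ballKernel [SFinite (unifMeasure K)] :
    Measurable (Function.uncurry (ballKernel K)) := by
  have hclosed : IsClosed {p : EuclideanSpace ℝ (Fin d) × EuclideanSpace ℝ (Fin d) |
      dist p.1 p.2 ≤ infDist p.2 Kᶜ} :=
    isClosed_le continuous_dist ((continuous_infDist_pt _).comp continuous_snd)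
  have h1 : Measurable fun p : EuclideanSpace ℝ (Fin d) × EuclideanSpace ℝ (Fin d) =>
      (closedBall p.2 (infDist p.2 Kᶜ)).indicator (fun _ => (1 : ℝ)) p.1 :=
    (measurable_const (a := (1 : ℝ))).indicator hclosed.measurableSet
  have h2 : Measurable fun y => (unifMeasure K (closedBall y (infDist y Kᶜ))).toReal :=
    (measurable_measure_prodMk_right hclosed.measurableSet).ennreal_toReal
  exact h1.div (h2.comp measurable_snd)

theorem integral_mul_ballKernel (g : EuclideanSpace ℝ (Fin d) → ℝ)
    (y : EuclideanSpace ℝ (Fin d)) :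
    ∫ x, g x * ballKernel K x y ∂unifMeasure K =
      (∫ x in closedBall y (infDist y Kᶜ), g x ∂unifMeasure K) /
        (unifMeasure K (closedBall y (infDist y Kᶜ))).toReal := by
  rw [← integral_indicator isClosed_closedBall.measurableSet, ← integral_div]
  congr 1 with x
  by_cases hx : x ∈ closedBall y (infDist y Kᶜ)
  · simp [ballKernel, indicator_of_mem hx, div_eq_mul_inv]
  · simp [ballKernel, indicator_of_notMem hx]

theorem ballKernel_nonneg (x y : EuclideanSpace ℝ (Fin d)) : 0 ≤ ballKernel K x y :=
  div_nonneg (indicator_nonneg (fun _ _ => zero_le_one) _) ENNReal.toReal_nonneg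

theorem integrable_ballKernel [IsFiniteMeasure (unifMeasure K)] :
    Integrable (Function.uncurry (ballKernel K)) ((unifMeasure K).prod (unifMeasure K)) := by
  have hm := measurable_ballKernel (K := K)
  rw [integrable_prod_iff' hm.aestronglyMeasurable]
  constructor
  · refine Filter.Eventually.of_forall fun y => ?_
    have h1 : Integrable (fun _ => (1 : ℝ)) (unifMeasure K) := integrable_const 1
    exact (h1.indicator (isClosed_closedBall (x := y) (ε := infDist y Kᶜ)).measurableSet).div_const
      (unifMeasure K (closedBall y (infDist y Kᶜ))).toReal
  · refine Integrable.of_bound (C := 1)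
      hm.norm.stronglyMeasurable.integral_prod_left'.aestronglyMeasurable ?_
    refine Filter.Eventually.of_forall fun y => ?_
    have h1 := integral_mul_ballKernel (K := K) (fun _ => 1) y
    simp only [one_mul, setIntegral_const, smul_eq_mul, mul_one, Measure.real] at h1
    simp only [Function.uncurry_apply_pair, Real.norm_of_nonneg (ballKernel_nonneg _ _), h1]
    rw [Real.norm_of_nonneg (by positivity)]
    exact div_self_le_one _

/-- If `g` agrees a.e. with its means over maximal balls, it is affine. -/
theorem exists_affine_of_ae_setIntegral_eq (hK : IsCompact K) (hne : (interior K).Nonempty)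
    (hKc : Kᶜ.Nonempty) {g : EuclideanSpace ℝ (Fin d) → ℝ} (hg : ConvexOn ℝ K g)
    (hc : ContinuousOn g K)
    (h : ∀ᵐ y ∂unifMeasure K, (∫ x in closedBall y (infDist y Kᶜ), g x ∂unifMeasure K) /
        (unifMeasure K (closedBall y (infDist y Kᶜ))).toReal = g y) :
    ∃ w : EuclideanSpace ℝ (Fin d) →ᵃ[ℝ] ℝ, ∀ x ∈ K, g x = w x := by
  have hlocal : ∀ z ∈ interior K, ∃ (L : EuclideanSpace ℝ (Fin d) →L[ℝ] ℝ) (a : ℝ),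
      ∀ᶠ x in 𝓝 z, g x = L x + a := by
    intro z hz
    have hz0 := infDist_compl_pos hKc hz
    set ε := infDist z Kᶜ / 2 with hε
    have hε0 : 0 < ε := by positivity
    have hvol : volume (ball z ε ∩ interior K) ≠ 0 :=
      ((isOpen_ball.inter isOpen_interior).measure_pos _ ⟨z, mem_ball_self hε0, hz⟩).ne'
    have hae : ∀ᵐ y ∂volume.restrict K,
        (∫ x in closedBall y (infDist y Kᶜ), g x ∂unifMeasure K) /
        (unifMeasure K (closedBall y (infDist y Kᶜ))).toReal = g y :=
      (Measure.ae_ennreal_smul_measure_iff (ENNReal.inv_ne_zero.2 hK.measure_lt_top.ne)).1 h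
    have hae' := ae_restrict_of_ae_restrict_of_subset
      (inter_subset_right.trans interior_subset : ball z ε ∩ interior K ⊆ K) hae
    obtain ⟨y, ⟨hyz, hyK⟩, hy⟩ : ∃ y ∈ ball z ε ∩ interior K,
        (∫ x in closedBall y (infDist y Kᶜ), g x ∂unifMeasure K) /
        (unifMeasure K (closedBall y (infDist y Kᶜ))).toReal = g y := by
      have : (ae (volume.restrict (ball z ε ∩ interior K))).NeBot := by
        rw [ae_neBot]
        simpa [Measure.restrict_eq_zero] using hvol
      exact ((ae_restrict_mem (isOpen_ball.inter isOpen_interior).measurableSet).and hae').exists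
    obtain ⟨L, a, hLa⟩ := (le_setIntegral_unifMeasure_div hK hne hKc hg hc hyK).2 hy
    refine ⟨L, a, ?_⟩
    have hz' : z ∈ ball y (infDist y Kᶜ) := by
      have h1 : infDist z Kᶜ ≤ infDist y Kᶜ + dist z y := infDist_le_infDist_add_dist
      rw [mem_ball, dist_comm] at hyz
      rw [mem_ball]
      linarith
    filter_upwards [isOpen_ball.mem_nhds hz'] with x hx
    exact hLa x hx
  obtain ⟨L, a, hLa⟩ := isOpen_interior.exists_eq_affine_of_locally
    hg.1.interior.isPreconnected hlocal
  refine ⟨L.toLinearMap.toAffineMap + AffineMap.const ℝ _ a, ?_⟩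
  have hcl : K ⊆ closure (interior K) := by
    rw [hg.1.closure_interior_eq_closure_of_nonempty_interior hne]
    exact subset_closure
  have heq : EqOn g (fun x => L x + a) K :=
    EqOn.of_subset_closure (s := interior K) hLa hc (by fun_prop) interior_subset hcl
  exact fun x hx => heq hx

theorem integral_mul_pS_pos (hK : IsCompact K) (hne : (interior K).Nonempty)
    (hKc : Kᶜ.Nonempty) {g : EuclideanSpace ℝ (Fin d) → ℝ} (hg : ConvexOn ℝ K g)
    (hc : ContinuousOn g K) (hmean : ∫ x, g x ∂unifMeasure K = 0)
    (hna : ¬ ∃ w : EuclideanSpace ℝ (Fin d) →ᵃ[ℝ] ℝ, ∀ x ∈ K, g x = w x) :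
    0 < ∫ x, g x * pS K x ∂unifMeasure K := by
  have := isProbabilityMeasure_unifMeasure hK hne
  have hint : ∀ᵐ y ∂unifMeasure K, y ∈ interior K := ae_mem_interior_unifMeasure hK hg.1
  have hgi : Integrable g (unifMeasure K) :=
    (hc.integrableOn_compact hK).smul_measure
      (ENNReal.inv_ne_top.2 (Measure.measure_pos_of_nonempty_interior _ hne).ne')
  obtain ⟨M, hM⟩ := hK.exists_bound_of_continuousOn hc
  have hF : Integrable (Function.uncurry fun x y => g x * ballKernel K x y)
      ((unifMeasure K).prod (unifMeasure K)) := by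
    refine integrable_ballKernel.bdd_mul (c := M) hgi.aestronglyMeasurable.comp_fst ?_
    filter_upwards [Measure.quasiMeasurePreserving_fst.ae hint] with p hp
    exact hM _ (interior_subset hp)
  have hswap : ∫ x, g x * pS K x ∂unifMeasure K =
      ∫ y, ∫ x, g x * ballKernel K x y ∂unifMeasure K ∂unifMeasure K := by
    rw [← integral_integral_swap hF]
    simp only [integral_const_mul]
    rfl
  have hA : Integrable (fun y => ∫ x, g x * ballKernel K x y ∂unifMeasure K) (unifMeasure K) :=
    hF.integral_prod_right
  have hnonneg : ∀ᵐ y ∂unifMeasure K,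
      0 ≤ (∫ x, g x * ballKernel K x y ∂unifMeasure K) - g y := by
    filter_upwards [hint] with y hy
    rw [integral_mul_ballKernel]
    exact sub_nonneg.2 (le_setIntegral_unifMeasure_div hK hne hKc hg hc hy).1
  have hsub := integral_sub hA hgi
  rw [hmean, sub_zero, ← hswap] at hsub
  rw [← hsub]
  refine lt_of_le_of_ne (integral_nonneg_of_ae hnonneg) fun h0 => hna ?_
  have hzero := (integral_eq_zero_iff_of_nonneg_ae hnonneg (hA.sub hgi)).1 h0.symm
  refine exists_affine_of_ae_setIntegral_eq hK hne hKc hg hc ?_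
  filter_upwards [hzero] with y hy
  rw [← integral_mul_ballKernel]
  exact sub_eq_zero.1 hy

end MaximalBalls

/-- if `g` is a non-affine convex function on the regular simplex `S`
with `∫_S g dU = 0`, then `∫_S g p_S dU > 0`. -/
theorem pS_strictly_positive_on_nonaffine
    (d : ℕ) (hd : 1 ≤ d) (v : Fin (d + 1) → EuclideanSpace ℝ (Fin d))
    (hv : IsRegularSimplexRadiusOne v)
    (g : EuclideanSpace ℝ (Fin d) → ℝ)
    (hgconv : ConvexOn ℝ (convexHull ℝ (Set.range v)) g)
    (hgcont : ContinuousOn g (convexHull ℝ (Set.range v)))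
    (hgmean : (∫ x, g x ∂(unifMeasure (convexHull ℝ (Set.range v)))) = 0)
    (hgnonaffine : ¬ ∃ w : EuclideanSpace ℝ (Fin d) →ᵃ[ℝ] ℝ,
      ∀ x ∈ convexHull ℝ (Set.range v), g x = w x) :
    0 < ∫ x, g x * pS (convexHull ℝ (Set.range v)) x
        ∂(unifMeasure (convexHull ℝ (Set.range v))) := by
  have hK : IsCompact (convexHull ℝ (range v)) := (finite_range v).isCompact_convexHull ℝ
  have hne : (interior (convexHull ℝ (range v))).Nonempty := by
    rw [interior_convexHull_nonempty_iff_affineSpan_eq_top,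
      hv.1.affineSpan_eq_top_iff_card_eq_finrank_add_one]
    simp
  have : Nonempty (Fin d) := ⟨⟨0, hd⟩⟩
  have hKc : (convexHull ℝ (range v))ᶜ.Nonempty := nonempty_compl.2 hK.ne_univ
  exact integral_mul_pS_pos hK hne hKc hgconv hgcont hgmean hgnonaffine
end

section
/- Let d ≥ 2, let S ⊂ ℝ^d be the regular simplex of radius one with uniform probability measure U, and define p_S(x) = ∫_S 1_{B_y}(x)/U(B_y) dU(y), where B_y is the largest ball centered at y contained in S. Then for every x ∈ S, p_S(x) ≤ 2^d · ((d+1)/(d−1)) · (v_{d−1}/v_d), where v_k denotes the Lebesgue volume of the unit ball in ℝ^k. -/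
open MeasureTheory Metric Set
open scoped ENNReal NNReal

/-- Cartesian coordinates whose first axis is the affine function `y ↦ ⟪u, y⟫ + c`. -/
theorem exists_measurePreserving_fst_eq_inner_add {n : ℕ}
    (u : EuclideanSpace ℝ (Fin (n + 1))) (hu : ‖u‖ = 1) (c : ℝ) :
    ∃ e : EuclideanSpace ℝ (Fin (n + 1)) → ℝ × EuclideanSpace ℝ (Fin n),
      MeasurePreserving e volume volume ∧ (∀ y, (e y).1 = inner ℝ u y + c) ∧
      ∀ x y, dist x y ^ 2 = dist (e x).1 (e y).1 ^ 2 + dist (e x).2 (e y).2 ^ 2 := by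
  have hon : Orthonormal ℝ
      (({0} : Set (Fin (n + 1))).domRestrict (fun _ : Fin (n + 1) => u)) := by
    rw [orthonormal_iff_ite]
    rintro ⟨i, rfl⟩ ⟨j, rfl⟩
    simp [hu]
  obtain ⟨b, hb⟩ := hon.exists_orthonormalBasis_extension_of_card_eq (by simp)
  have hb0 : b 0 = u := hb 0 rfl
  refine ⟨Prod.map (· + c) (WithLp.toLp 2) ∘
    MeasurableEquiv.piFinSuccAbove (fun _ => ℝ) 0 ∘ WithLp.ofLp ∘ b.repr, ?_, ?_, ?_⟩
  · exact ((measurePreserving_add_right volume c).prod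
      (PiLp.volume_preserving_toLp (Fin n))).comp
      ((volume_preserving_piFinSuccAbove (fun _ => ℝ) 0).comp
        ((PiLp.volume_preserving_ofLp (Fin (n + 1))).comp b.measurePreserving_repr))
  · intro y
    simp [MeasurableEquiv.piFinSuccAbove, b.repr_apply_apply, hb0]
  · intro x y
    rw [← b.repr.dist_map x y, EuclideanSpace.dist_sq_eq, EuclideanSpace.dist_sq_eq,
      Fin.sum_univ_succ]
    simp [MeasurableEquiv.piFinSuccAbove, Fin.tail]

theorem lintegral_Ici_sqrt_pow_mul_inv_pow_le {n : ℕ} (hn : 0 < n) {a : ℝ} (ha : 0 ≤ a) :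
    ∫⁻ t in Ici (a / 2), ENNReal.ofReal (√(2 * a * t) ^ n * (t ^ (n + 1))⁻¹) ≤
      ENNReal.ofReal (2 ^ (n + 1) / n) := by
  rcases ha.eq_or_lt with rfl | ha
  · simp [hn.ne']
  have hn' : (0 : ℝ) < n := by exact_mod_cast hn
  have ha2 : 0 < a / 2 := by positivity
  have hexp : -((n : ℝ) / 2) - 1 < -1 := by linarith
  have hcongr : ∀ t ∈ Ioi (a / 2), √(2 * a * t) ^ n * (t ^ (n + 1))⁻¹ =
      (2 * a) ^ ((n : ℝ) / 2) * t ^ (-((n : ℝ) / 2) - 1) := by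
    intro t ht
    have ht : 0 < t := ha2.trans ht
    rw [Real.sqrt_eq_rpow, ← Real.rpow_natCast, ← Real.rpow_mul (by positivity),
      Real.mul_rpow (by positivity) ht.le, ← Real.rpow_natCast t, ← Real.rpow_neg ht.le, mul_assoc,
      ← Real.rpow_add ht]
    congr 2 <;> push_cast <;> ring
  rw [setLIntegral_congr (Ioi_ae_eq_Ici (a := a / 2)).symm,
    setLIntegral_congr_fun measurableSet_Ioi
      (fun t ht => congrArg ENNReal.ofReal (hcongr t ht)),
    ← ofReal_integral_eq_lintegral_ofReal]
  · refine ENNReal.ofReal_le_ofReal (le_of_eq ?_)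
    rw [integral_const_mul, integral_Ioi_rpow_of_lt hexp ha2]
    have h4 : (2 * a) ^ ((n : ℝ) / 2) = 2 ^ n * (a / 2) ^ ((n : ℝ) / 2) := by
      rw [show 2 * a = 2 ^ (2 : ℝ) * (a / 2) by norm_num; ring,
        Real.mul_rpow (by positivity) ha2.le, ← Real.rpow_mul (by norm_num),
        mul_div_cancel₀ _ (by norm_num : (2 : ℝ) ≠ 0), Real.rpow_natCast]
    rw [h4, show -((n : ℝ) / 2) - 1 + 1 = -((n : ℝ) / 2) by ring, Real.rpow_neg ha2.le]
    have : (a / 2) ^ ((n : ℝ) / 2) ≠ 0 := (Real.rpow_pos_of_pos ha2 _).ne'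
    field_simp
    ring
  · exact (integrableOn_Ioi_rpow_of_lt hexp ha2).const_mul _
  · filter_upwards [ae_restrict_mem measurableSet_Ioi] with t ht
    have ht : 0 < t := ha2.trans ht
    positivity

/-- The integral of `h⁻⁽ⁿ⁺¹⁾`, with `h` the distance to a hyperplane, over the points that are at
least as close to `x` as to that hyperplane. -/
theorem lintegral_indicator_dist_le_affine_inv_pow_le {n : ℕ} (hn : 0 < n)
    (u : EuclideanSpace ℝ (Fin (n + 1))) (hu : ‖u‖ = 1) (c : ℝ)
    (x : EuclideanSpace ℝ (Fin (n + 1))) (hx : 0 ≤ inner ℝ u x + c) :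
    ∫⁻ y, {y | 0 < inner ℝ u y + c ∧ dist x y ≤ inner ℝ u y + c}.indicator
        (fun y => ENNReal.ofReal (((inner ℝ u y + c) ^ (n + 1))⁻¹)) y ≤
      ENNReal.ofReal (2 ^ (n + 1) / n) *
        volume (ball (0 : EuclideanSpace ℝ (Fin n)) 1) := by
  obtain ⟨e, he, he1, he2⟩ := exists_measurePreserving_fst_eq_inner_add u hu c
  set a := inner ℝ u x + c
  set A : Set (ℝ × EuclideanSpace ℝ (Fin n)) :=
    {p | 0 < p.1 ∧ dist a p.1 ^ 2 + dist (e x).2 p.2 ^ 2 ≤ p.1 ^ 2} with hA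
  have hAm : MeasurableSet A :=
    (measurableSet_lt measurable_const measurable_fst).inter
      (measurableSet_le
        (f := fun p : ℝ × EuclideanSpace ℝ (Fin n) =>
          dist a p.1 ^ 2 + dist (e x).2 p.2 ^ 2)
        (g := fun p => p.1 ^ 2) (by fun_prop) (by fun_prop))
  set G : ℝ × EuclideanSpace ℝ (Fin n) → ℝ≥0∞ :=
    A.indicator (fun p => ENNReal.ofReal ((p.1 ^ (n + 1))⁻¹)) with hG
  have hGm : Measurable G := Measurable.indicator (by fun_prop) hAm
  have hcomp : ∀ y, {y | 0 < inner ℝ u y + c ∧ dist x y ≤ inner ℝ u y + c}.indicator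
        (fun y => ENNReal.ofReal (((inner ℝ u y + c) ^ (n + 1))⁻¹)) y = G (e y) := by
    intro y
    have hiff : e y ∈ A ↔
        y ∈ {y | 0 < inner ℝ u y + c ∧ dist x y ≤ inner ℝ u y + c} := by
      simp only [hA, mem_ofPred_eq, ← he1 y]
      refine and_congr_right fun h => ?_
      rw [← sq_le_sq₀ dist_nonneg h.le, he2, he1 x]
    by_cases hy : e y ∈ A
    · rw [hG, indicator_of_mem hy, indicator_of_mem (hiff.1 hy), he1 y]
    · rw [hG, indicator_of_notMem hy, indicator_of_notMem (mt hiff.2 hy)]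
  simp_rw [hcomp]
  rw [he.lintegral_comp hGm, Measure.volume_eq_prod, lintegral_prod _ hGm.aemeasurable]
  have hslice : ∀ t, ∫⁻ z, G (t, z) ≤ (Ici (a / 2)).indicator
      (fun t => ENNReal.ofReal (√(2 * a * t) ^ n * (t ^ (n + 1))⁻¹)) t *
        volume (ball (0 : EuclideanSpace ℝ (Fin n)) 1) := by
    intro t
    by_cases ht : 0 < t ∧ a / 2 ≤ t
    · obtain ⟨ht, hat⟩ := ht
      calc ∫⁻ z, G (t, z)
          ≤ ∫⁻ z, (closedBall (e x).2 √(2 * a * t)).indicator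
              (fun _ => ENNReal.ofReal ((t ^ (n + 1))⁻¹)) z := by
            refine lintegral_mono fun z => ?_
            by_cases hz : (t, z) ∈ A
            · have hz' : z ∈ closedBall (e x).2 √(2 * a * t) := by
                have h := hz.2
                simp only [Real.dist_eq, sq_abs] at h
                rw [mem_closedBall, dist_comm]
                refine Real.le_sqrt_of_sq_le ?_
                nlinarith [sq_nonneg a]
              rw [hG, indicator_of_mem hz, indicator_of_mem hz']
            · rw [hG, indicator_of_notMem hz]
              exact zero_le
        _ = _ := by
            rw [lintegral_indicator measurableSet_closedBall, setLIntegral_const,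
              Measure.addHaar_closedBall _ _ (Real.sqrt_nonneg _), indicator_of_mem (mem_Ici.2 hat),
              ENNReal.ofReal_mul (by positivity)]
            simp only [finrank_euclideanSpace_fin]
            ring
    · have : ∀ z, G (t, z) = 0 := by
        intro z
        refine indicator_of_notMem ?_ _
        rintro ⟨h0, h1⟩
        simp only [Real.dist_eq, sq_abs] at h0 h1
        refine ht ⟨h0, ?_⟩
        nlinarith [sq_nonneg (dist (e x).2 z)]
      simp [this]
  calc ∫⁻ t, ∫⁻ z, G (t, z) ≤ _ := lintegral_mono hslice
    _ = (∫⁻ t in Ici (a / 2), ENNReal.ofReal (√(2 * a * t) ^ n * (t ^ (n + 1))⁻¹)) *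
        volume (ball (0 : EuclideanSpace ℝ (Fin n)) 1) := by
      rw [lintegral_mul_const _ (Measurable.indicator (by fun_prop) measurableSet_Ici),
        lintegral_indicator measurableSet_Ici]
    _ ≤ _ := by gcongr; exact lintegral_Ici_sqrt_pow_mul_inv_pow_le hn hx

/-- A nonconstant affine function is a positive multiple of a signed distance to a hyperplane. -/
theorem AffineMap.exists_eq_mul_inner_add {E : Type*} [NormedAddCommGroup E]
    [InnerProductSpace ℝ E] [FiniteDimensional ℝ E] (f : E →ᵃ[ℝ] ℝ) {p q : E}
    (hpq : f p ≠ f q) :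
    ∃ (u : E) (c k : ℝ), ‖u‖ = 1 ∧ 0 < k ∧ ∀ y, f y = k * (inner ℝ u y + c) := by
  set w := (InnerProductSpace.toDual ℝ E).symm (LinearMap.toContinuousLinearMap f.linear)
  have hw : ∀ y, f y = inner ℝ w y + f 0 := by
    intro y
    rw [InnerProductSpace.toDual_symm_apply]
    simp [f.decomp']
  have hw0 : w ≠ 0 := by
    intro h
    exact hpq (by rw [hw p, hw q, h]; simp)
  have hk : 0 < ‖w‖ := norm_pos_iff.2 hw0
  refine ⟨‖w‖⁻¹ • w, ‖w‖⁻¹ * f 0, ‖w‖, ?_, hk, fun y => ?_⟩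
  · rw [norm_smul, norm_inv, norm_norm, inv_mul_cancel₀ hk.ne']
  · rw [hw y, real_inner_smul_left]
    field_simp

/-- A simplex is an intersection of half-spaces in Hesse normal form. -/
theorem AffineIndependent.exists_convexHull_eq_halfSpaces {n : ℕ}
    {v : Fin (n + 1) → EuclideanSpace ℝ (Fin n)} (hv : AffineIndependent ℝ v) (hn : 0 < n) :
    ∃ (u : Fin (n + 1) → EuclideanSpace ℝ (Fin n)) (c : Fin (n + 1) → ℝ),
      (∀ i, ‖u i‖ = 1) ∧ convexHull ℝ (range v) = {y | ∀ i, 0 ≤ inner ℝ (u i) y + c i} := by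
  have htop : affineSpan ℝ (range v) = ⊤ :=
    hv.affineSpan_eq_top_iff_card_eq_finrank_add_one.2 (by simp)
  let b : AffineBasis (Fin (n + 1)) ℝ (EuclideanSpace ℝ (Fin n)) := ⟨v, hv, htop⟩
  have : Nontrivial (Fin (n + 1)) := Fin.nontrivial_iff_two_le.2 (by omega)
  have hex : ∀ i, ∃ (u : EuclideanSpace ℝ (Fin n)) (c k : ℝ), ‖u‖ = 1 ∧ 0 < k ∧
      ∀ y, b.coord i y = k * (inner ℝ u y + c) := by
    intro i
    obtain ⟨j, hj⟩ := exists_ne i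
    refine (b.coord i).exists_eq_mul_inner_add (p := b i) (q := b j) ?_
    rw [b.coord_apply_eq, b.coord_apply_ne hj.symm]
    exact one_ne_zero
  choose u c k hu hk h using hex
  refine ⟨u, c, hu, ?_⟩
  rw [show range v = range b from rfl, b.convexHull_eq_nonneg_coord]
  ext y
  simp only [mem_ofPred_eq, h, mul_nonneg_iff_of_pos_left (hk _)]

section HalfSpaces

variable {E ι : Type*} [NormedAddCommGroup E] [InnerProductSpace ℝ E] {u : ι → E} {c : ι → ℝ}

theorem infDist_compl_halfSpaces_le (hu : ∀ i, ‖u i‖ = 1) {y : E}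
    (hy : ∀ i, 0 ≤ inner ℝ (u i) y + c i) (i : ι) :
    infDist y {y | ∀ i, 0 ≤ inner ℝ (u i) y + c i}ᶜ ≤ inner ℝ (u i) y + c i := by
  refine le_of_forall_pos_le_add fun ε hε => ?_
  set r := inner ℝ (u i) y + c i + ε
  have hr : 0 < r := add_pos_of_nonneg_of_pos (hy i) hε
  have hmem : y - r • u i ∈ {y | ∀ i, 0 ≤ inner ℝ (u i) y + c i}ᶜ := by
    intro h
    have := h i
    rw [inner_sub_right, real_inner_smul_right, real_inner_self_eq_norm_sq, hu] at this
    linarith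
  refine (infDist_le_dist_of_mem hmem).trans (le_of_eq ?_)
  simp [norm_smul, hu, abs_of_pos hr]

theorem exists_affine_le_infDist_compl_halfSpaces [Finite ι] [Nonempty ι]
    (hu : ∀ i, ‖u i‖ = 1) (y : E) :
    ∃ i, inner ℝ (u i) y + c i ≤ infDist y {y | ∀ i, 0 ≤ inner ℝ (u i) y + c i}ᶜ := by
  obtain ⟨i, hi⟩ := Finite.exists_min fun i => inner ℝ (u i) y + c i
  refine ⟨i, ?_⟩
  have hne : {y | ∀ i, 0 ≤ inner ℝ (u i) y + c i}ᶜ.Nonempty := by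
    refine ⟨y - (inner ℝ (u i) y + c i + 1) • u i, fun h => ?_⟩
    have := h i
    rw [inner_sub_right, real_inner_smul_right, real_inner_self_eq_norm_sq, hu] at this
    linarith
  refine (le_infDist hne).2 fun z hz => ?_
  simp only [mem_compl_iff, mem_ofPred_eq, not_forall, not_le] at hz
  obtain ⟨j, hj⟩ := hz
  have h1 : inner ℝ (u j) (y - z) ≤ dist y z := by
    simpa [hu, dist_eq_norm] using real_inner_le_norm (u j) (y - z)
  rw [inner_sub_right] at h1
  linarith [hi j]

theorem closedBall_infDist_compl_subset_halfSpaces (hu : ∀ i, ‖u i‖ = 1) {y : E}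
    (hy : ∀ i, 0 ≤ inner ℝ (u i) y + c i) :
    closedBall y (infDist y {y | ∀ i, 0 ≤ inner ℝ (u i) y + c i}ᶜ) ⊆
      {y | ∀ i, 0 ≤ inner ℝ (u i) y + c i} := by
  intro z hz i
  have h1 : inner ℝ (u i) (y - z) ≤ dist y z := by
    simpa [hu, dist_eq_norm] using real_inner_le_norm (u i) (y - z)
  rw [inner_sub_right] at h1
  rw [mem_closedBall, dist_comm] at hz
  linarith [infDist_compl_halfSpaces_le hu hy i]

end HalfSpaces

/-- A uniform bound on `pS` for a bounded intersection of finitely many half-spaces. -/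
theorem pS_halfSpaces_le {ι : Type*} [Fintype ι] [Nonempty ι] {n : ℕ} (hn : 0 < n)
    {u : ι → EuclideanSpace ℝ (Fin (n + 1))} {c : ι → ℝ} (hu : ∀ i, ‖u i‖ = 1)
    {S : Set (EuclideanSpace ℝ (Fin (n + 1)))}
    (hS : S = {y | ∀ i, 0 ≤ inner ℝ (u i) y + c i}) (hSm : MeasurableSet S)
    (hfin : volume S ≠ ∞) {x : EuclideanSpace ℝ (Fin (n + 1))} (hx : x ∈ S) :
    pS S x ≤ Fintype.card ι * (2 ^ (n + 1) / n *
      ((volume (ball (0 : EuclideanSpace ℝ (Fin n)) 1)).toReal /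
        (volume (ball (0 : EuclideanSpace ℝ (Fin (n + 1))) 1)).toReal)) := by
  set V := volume (ball (0 : EuclideanSpace ℝ (Fin n)) 1)
  set W := volume (ball (0 : EuclideanSpace ℝ (Fin (n + 1))) 1)
  have hW0 : 0 < W.toReal :=
    ENNReal.toReal_pos (measure_ball_pos _ _ one_pos).ne' measure_ball_lt_top.ne
  have hVtop : V ≠ ∞ := measure_ball_lt_top.ne
  rcases eq_or_ne (volume S) 0 with h0 | h0
  · have : unifMeasure S = 0 := by
      rw [unifMeasure, Measure.restrict_eq_zero.2 h0, smul_zero]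
    rw [pS, this, integral_zero_measure]
    positivity
  have hs : 0 < (volume S).toReal := ENNReal.toReal_pos h0 hfin
  set r := fun y => infDist y Sᶜ with hr
  set F := fun i => {y | 0 < inner ℝ (u i) y + c i ∧
    dist x y ≤ inner ℝ (u i) y + c i}.indicator
      (fun y => ENNReal.ofReal (((inner ℝ (u i) y + c i) ^ (n + 1))⁻¹)) with hF
  have hFm : ∀ i, Measurable (F i) := fun i => by
    refine Measurable.indicator (by fun_prop) ?_
    have hm : Measurable fun y => inner ℝ (u i) y + c i := by fun_prop
    exact (measurableSet_lt measurable_const hm).inter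
      (measurableSet_le (f := fun y => dist x y) (by fun_prop) hm)
  have hball : ∀ y ∈ S, ((unifMeasure S) (closedBall y (r y))).toReal =
      r y ^ (n + 1) * W.toReal / (volume S).toReal := by
    intro y hy
    have hsub : closedBall y (r y) ⊆ S := by
      simp only [hr, hS] at hy ⊢
      exact closedBall_infDist_compl_subset_halfSpaces hu hy
    rw [unifMeasure, Measure.smul_apply, Measure.restrict_apply measurableSet_closedBall,
      inter_eq_self_of_subset_left hsub, Measure.addHaar_closedBall _ _ infDist_nonneg]
    simp only [finrank_euclideanSpace_fin, smul_eq_mul, ENNReal.toReal_mul, ENNReal.toReal_inv]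
    rw [ENNReal.toReal_ofReal (pow_nonneg infDist_nonneg _)]
    field_simp
    rfl
  have hpt : ∀ y ∈ S, ENNReal.ofReal ‖(closedBall y (r y)).indicator (fun _ => (1 : ℝ)) x /
      ((unifMeasure S) (closedBall y (r y))).toReal‖ ≤
      ENNReal.ofReal ((volume S).toReal / W.toReal) * ∑ i, F i y := by
    intro y hy
    rw [hball y hy]
    by_cases hxy : x ∈ closedBall y (r y)
    swap
    · simp [hxy]
    have hrn : 0 ≤ r y := infDist_nonneg
    rcases hrn.eq_or_lt with hr0 | hr0
    · simp [← hr0]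
    have hy' := hy
    rw [hS] at hy'
    obtain ⟨i, hi⟩ := exists_affine_le_infDist_compl_halfSpaces (c := c) hu y
    have hi' := infDist_compl_halfSpaces_le hu hy' i
    rw [← hS] at hi hi'
    have hri : inner ℝ (u i) y + c i = r y := le_antisymm hi hi'
    have hFi : F i y = ENNReal.ofReal ((r y ^ (n + 1))⁻¹) := by
      simp only [hF]
      rw [indicator_of_mem, hri]
      exact ⟨hri ▸ hr0, hri ▸ hxy⟩
    refine le_trans (le_of_eq ?_) (mul_le_mul_right
      (Finset.single_le_sum (f := fun i => F i y) (fun _ _ => zero_le) (Finset.mem_univ i)) _)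
    rw [hFi, ← ENNReal.ofReal_mul (by positivity), indicator_of_mem hxy,
      Real.norm_of_nonneg (by positivity)]
    congr 1
    field_simp
  have hbound : ∫⁻ y, ENNReal.ofReal ‖(closedBall y (r y)).indicator (fun _ => (1 : ℝ)) x /
      ((unifMeasure S) (closedBall y (r y))).toReal‖ ∂(unifMeasure S) ≤
      (volume S)⁻¹ * (ENNReal.ofReal ((volume S).toReal / W.toReal) *
        (Fintype.card ι * (ENNReal.ofReal (2 ^ (n + 1) / n) * V))) := by
    conv_lhs => rw [unifMeasure, lintegral_smul_measure, smul_eq_mul]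
    rw [← unifMeasure]
    gcongr
    calc _ ≤ ∫⁻ y in S, ENNReal.ofReal ((volume S).toReal / W.toReal) * ∑ i, F i y :=
          setLIntegral_mono' hSm hpt
      _ ≤ ∫⁻ y, ENNReal.ofReal ((volume S).toReal / W.toReal) * ∑ i, F i y :=
          setLIntegral_le_lintegral _ _
      _ = ENNReal.ofReal ((volume S).toReal / W.toReal) * ∑ i, ∫⁻ y, F i y := by
          rw [lintegral_const_mul _ (Finset.measurable_fun_sum _ fun i _ => hFm i),
            lintegral_finsetSum _ fun i _ => hFm i]
      _ ≤ _ := by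
          gcongr
          refine (Finset.sum_le_card_nsmul _ _ _ fun i _ =>
            lintegral_indicator_dist_le_affine_inv_pow_le hn (u i) (hu i) (c i) x ?_).trans
              (le_of_eq ?_)
          · rw [hS] at hx
            exact hx i
          · rw [nsmul_eq_mul, Finset.card_univ]
  have hne : (volume S)⁻¹ * (ENNReal.ofReal ((volume S).toReal / W.toReal) *
        (Fintype.card ι * (ENNReal.ofReal (2 ^ (n + 1) / n) * V))) ≠ ∞ := by
    finiteness
  calc pS S x ≤ ‖pS S x‖ := Real.le_norm_self _
    _ ≤ _ := norm_integral_le_lintegral_norm _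
    _ ≤ _ := ENNReal.toReal_mono hne hbound
    _ = _ := by
      simp only [ENNReal.toReal_mul, ENNReal.toReal_inv, ENNReal.toReal_natCast]
      rw [ENNReal.toReal_ofReal (by positivity), ENNReal.toReal_ofReal (by positivity)]
      field_simp

/-- uniform bound `p_S(x) ≤ 2^d ((d+1)/(d-1)) v_{d-1}/v_d` on the
regular simplex of radius one, where `v_k` is the volume of the unit ball in `ℝ^k`. -/
theorem pS_uniform_bound
    (d : ℕ) (hd : 2 ≤ d) (v : Fin (d + 1) → EuclideanSpace ℝ (Fin d))
    (hv : IsRegularSimplexRadiusOne v)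
    (x : EuclideanSpace ℝ (Fin d)) (hx : x ∈ convexHull ℝ (Set.range v)) :
    pS (convexHull ℝ (Set.range v)) x ≤
      2 ^ d * (((d : ℝ) + 1) / ((d : ℝ) - 1)) *
        ((volume (Metric.ball (0 : EuclideanSpace ℝ (Fin (d - 1))) 1)).toReal /
          (volume (Metric.ball (0 : EuclideanSpace ℝ (Fin d)) 1)).toReal) := by
  obtain ⟨n, rfl⟩ : ∃ n, d = n + 1 := ⟨d - 1, by omega⟩
  have hn : 0 < n := by omega
  obtain ⟨u, c, hu, hS⟩ := hv.1.exists_convexHull_eq_halfSpaces n.succ_pos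
  have hcpt : IsCompact (convexHull ℝ (range v)) := (finite_range v).isCompact_convexHull ℝ
  refine (pS_halfSpaces_le hn hu hS hcpt.measurableSet hcpt.measure_lt_top.ne hx).trans
    (le_of_eq ?_)
  simp only [Fintype.card_fin]
  push_cast
  rw [add_sub_cancel_right]
  ring
end

section
/- Let d ≥ 2, let H = {y ∈ ℝ^d : y_1 = 0}, let x_0 > 0 and x = (x_0, 0, …, 0) ∈ ℝ^d, and let P_x = {y ∈ ℝ^d : y_1 > 0 and |y − x| ≤ y_1} be the set of points closer to x than to the hyperplane H. Then ∫_{P_x} y_1^{-d} dy ≤ v_{d−1} · 2^d/(d−1), where v_{d−1} is the Lebesgue volume of the unit ball in ℝ^{d−1} and dy is Lebesgue measure on ℝ^d; in particular the bound is independent of x_0. -/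
open MeasureTheory Metric Set
open scoped ENNReal NNReal

/-- Splitting off the first coordinate of Euclidean space preserves Lebesgue measure. -/
theorem EuclideanSpace.measurePreserving_head_tail (n : ℕ) :
    MeasurePreserving (fun y : EuclideanSpace ℝ (Fin (n + 1)) =>
      ((y 0, WithLp.toLp 2 fun i => y i.succ) : ℝ × EuclideanSpace ℝ (Fin n))) := by
  have h1 := EuclideanSpace.volume_preserving_symm_measurableEquiv_toLp (Fin (n + 1))
  have h2 := volume_preserving_piFinSuccAbove (fun _ : Fin (n + 1) => ℝ) 0
  have h3 := PiLp.volume_preserving_toLp (Fin n)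
  have h4 := (MeasurePreserving.id (volume : Measure ℝ)).prod h3
  exact h4.comp (h2.comp h1)

theorem lintegral_paraboloid_slices (n : ℕ) (hn : 1 ≤ n) (x0 : ℝ) (hx0 : 0 < x0) :
    ∫⁻ t in Ioi (x0 / 2), ENNReal.ofReal ((t ^ (n + 1))⁻¹ * √(2 * x0 * t) ^ n) =
      ENNReal.ofReal (2 ^ (n + 1) / n) := by
  have hn' : (0 : ℝ) < n := by exact_mod_cast hn
  have hlt : -(n / 2 : ℝ) - 1 < -1 := by linarith
  have hx : 0 < x0 / 2 := by positivity
  have hpt : ∀ t ∈ Ioi (x0 / 2), (t ^ (n + 1))⁻¹ * √(2 * x0 * t) ^ n =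
      √(2 * x0) ^ n * t ^ (-(n / 2 : ℝ) - 1) := by
    intro t ht
    have ht0 : 0 < t := hx.trans ht
    have h1 : √t ^ n = t ^ (n / 2 : ℝ) := by
      rw [Real.sqrt_eq_rpow, ← Real.rpow_natCast, ← Real.rpow_mul ht0.le]
      ring_nf
    rw [Real.sqrt_mul (by positivity), mul_pow, h1, ← Real.rpow_natCast t (n + 1),
      ← Real.rpow_neg ht0.le, mul_left_comm, ← Real.rpow_add ht0]
    congr 2
    push_cast
    ring
  rw [setLIntegral_congr_fun measurableSet_Ioi fun t ht => by rw [hpt t ht],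
    ← ofReal_integral_eq_lintegral_ofReal ((integrableOn_Ioi_rpow_of_lt hlt hx).const_mul _)
      ((ae_restrict_iff' measurableSet_Ioi).2 <| .of_forall fun t ht => by
        have : 0 < t := hx.trans ht
        dsimp only [Pi.zero_apply]
        positivity),
    integral_const_mul, integral_Ioi_rpow_of_lt hlt hx]
  congr 1
  have h2 : (x0 / 2) ^ (-(n / 2 : ℝ) - 1 + 1) = (√(x0 / 2) ^ n)⁻¹ := by
    rw [Real.sqrt_eq_rpow, ← Real.rpow_natCast, ← Real.rpow_mul hx.le, ← Real.rpow_neg hx.le]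
    ring_nf
  have h3 : √(2 * x0) = 2 * √(x0 / 2) := by
    rw [show 2 * x0 = 2 ^ 2 * (x0 / 2) by ring, Real.sqrt_mul (by positivity),
      Real.sqrt_sq (by norm_num)]
  have h4 : 0 < √(x0 / 2) := Real.sqrt_pos.2 hx
  rw [h2, h3, mul_pow, sub_add_cancel]
  field_simp
  ring

theorem measurableSet_paraboloid (n : ℕ) (x0 : ℝ) : MeasurableSet
    {p : ℝ × EuclideanSpace ℝ (Fin n) | x0 / 2 ≤ p.1 ∧ ‖p.2‖ ≤ √(2 * x0 * p.1)} := by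
  have h : Measurable fun p : ℝ × EuclideanSpace ℝ (Fin n) => √(2 * x0 * p.1) := by fun_prop
  exact (measurableSet_le measurable_const measurable_fst).inter
    (measurableSet_le measurable_snd.norm h)

/-- The integral of `t ^ -(n + 1)` over the solid paraboloid `‖z‖ ≤ √(2 x₀ t)`, `t ≥ x₀ / 2`. -/
theorem setLIntegral_paraboloid (n : ℕ) (hn : 1 ≤ n) (x0 : ℝ) (hx0 : 0 < x0) :
    ∫⁻ p in {p : ℝ × EuclideanSpace ℝ (Fin n) | x0 / 2 ≤ p.1 ∧ ‖p.2‖ ≤ √(2 * x0 * p.1)},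
      ENNReal.ofReal (p.1 ^ (n + 1))⁻¹ =
      ENNReal.ofReal (2 ^ (n + 1) / n) * volume (ball (0 : EuclideanSpace ℝ (Fin n)) 1) := by
  have hT := measurableSet_paraboloid n x0
  rw [← lintegral_indicator hT, Measure.volume_eq_prod, lintegral_prod _
    ((Measurable.indicator (by fun_prop) hT).aemeasurable)]
  rw [← lintegral_paraboloid_slices n hn x0 hx0, ← lintegral_mul_const _ (by fun_prop),
    setLIntegral_congr Ioi_ae_eq_Ici, ← lintegral_indicator measurableSet_Ici]
  refine lintegral_congr fun t => ?_
  by_cases ht : x0 / 2 ≤ t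
  · have ht0 : 0 < t := by linarith
    have : ∀ z : EuclideanSpace ℝ (Fin n),
        indicator {p : ℝ × EuclideanSpace ℝ (Fin n) | x0 / 2 ≤ p.1 ∧ ‖p.2‖ ≤ √(2 * x0 * p.1)}
          (fun p => ENNReal.ofReal (p.1 ^ (n + 1))⁻¹) (t, z) =
        indicator (closedBall 0 √(2 * x0 * t)) (fun _ => ENNReal.ofReal (t ^ (n + 1))⁻¹) z := by
      intro z
      simp [indicator, ht]
    rw [lintegral_congr this, lintegral_indicator_const measurableSet_closedBall,
      Measure.addHaar_closedBall _ _ (Real.sqrt_nonneg _), indicator_of_mem (mem_Ici.2 ht),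
      ENNReal.ofReal_mul (by positivity), finrank_euclideanSpace_fin, ← mul_assoc]
  · simp [indicator, ht]

/-- The bound in dimension `n + 1`, with the first coordinate written as `y 0`. -/
theorem setIntegral_closer_to_point_le
    (n : ℕ) (hn : 1 ≤ n) (x0 : ℝ) (hx0 : 0 < x0) :
    (∫ y in {y : EuclideanSpace ℝ (Fin (n + 1)) |
        0 < y 0 ∧ dist y (EuclideanSpace.single 0 x0) ≤ y 0}, ((y 0) ^ (n + 1))⁻¹) ≤
      (volume (ball (0 : EuclideanSpace ℝ (Fin n)) 1)).toReal * 2 ^ (n + 1) / n := by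
  have hS : MeasurableSet {y : EuclideanSpace ℝ (Fin (n + 1)) |
      0 < y 0 ∧ dist y (EuclideanSpace.single 0 x0) ≤ y 0} := by
    have h0 : Measurable fun y : EuclideanSpace ℝ (Fin (n + 1)) => y 0 := by fun_prop
    exact (measurableSet_lt measurable_const h0).inter
      (measurableSet_le (measurable_id.dist measurable_const) h0)
  rw [integral_eq_lintegral_of_nonneg_ae
    ((ae_restrict_iff' hS).2 <| .of_forall fun y hy => by
      have := hy.1
      dsimp only [Pi.zero_apply]
      positivity)
    (Measurable.aestronglyMeasurable (by fun_prop))]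
  have hT := measurableSet_paraboloid n x0
  have key := (EuclideanSpace.measurePreserving_head_tail n).setLIntegral_comp_preimage hT
    (f := fun p => ENNReal.ofReal (p.1 ^ (n + 1))⁻¹) (by fun_prop)
  rw [setLIntegral_paraboloid n hn x0 hx0] at key
  have hle := key ▸ lintegral_mono_set (μ := volume)
    (f := fun y : EuclideanSpace ℝ (Fin (n + 1)) => ENNReal.ofReal (y 0 ^ (n + 1))⁻¹)
    (s := {y : EuclideanSpace ℝ (Fin (n + 1)) |
      0 < y 0 ∧ dist y (EuclideanSpace.single 0 x0) ≤ y 0}) (by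
      rintro y ⟨hy0, hy⟩
      rw [EuclideanSpace.dist_eq, Real.sqrt_le_left hy0.le, Fin.sum_univ_succ] at hy
      simp only [PiLp.single_apply, Fin.succ_ne_zero, if_true, if_false, Real.dist_eq, sq_abs,
        sub_zero] at hy
      have hz : 0 ≤ ∑ i : Fin n, y i.succ ^ 2 := by positivity
      refine ⟨?_, ?_⟩
      · show x0 / 2 ≤ y 0
        nlinarith
      · simp only [EuclideanSpace.norm_eq, Real.norm_eq_abs, sq_abs]
        exact Real.sqrt_le_sqrt (by nlinarith))
  refine (ENNReal.toReal_mono (by finiteness) hle).trans_eq ?_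
  rw [ENNReal.toReal_mul, ENNReal.toReal_ofReal (by positivity)]
  ring

/-- the integral of `y₁^{-d}` over the paraboloid region
`P_x = {y : y₁ > 0, |y − x| ≤ y₁}` (points closer to `x = (x₀,0,…,0)` than to the
hyperplane `{y₁ = 0}`) is at most `v_{d-1} 2^d/(d-1)`, independently of `x₀ > 0`. -/
theorem paraboloid_potential_integral_bound
    (d : ℕ) (hd : 2 ≤ d) (x0 : ℝ) (hx0 : 0 < x0) :
    (∫ y in {y : EuclideanSpace ℝ (Fin d) |
        0 < y (Fin.mk 0 (by omega)) ∧
        dist y (EuclideanSpace.single (Fin.mk 0 (by omega)) x0) ≤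
          y (Fin.mk 0 (by omega))},
      ((y (Fin.mk 0 (by omega))) ^ d)⁻¹) ≤
      (volume (Metric.ball (0 : EuclideanSpace ℝ (Fin (d - 1))) 1)).toReal *
        2 ^ d / ((d : ℝ) - 1) := by
  obtain ⟨n, rfl⟩ : ∃ n, d = n + 1 := ⟨d - 1, by omega⟩
  have h := setIntegral_closer_to_point_le n (by omega) x0 hx0
  rw [Nat.cast_add_one, add_sub_cancel_right]
  exact h
end
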